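/- Let (P, Γ, ν) be a structure such that the graph {(y,u) : u ∈ Γ(y)} is closed in ℝ^{d_y} × ℝ^{d_u}. Then (P, Γ, ν) is internally consistent if and only if sup over Borel sets A ⊆ ℝ^{d_y} of [P(A) − ν(Γ(A))] equals 0, i.e. if and only if P(A) ≤ ν(Γ(A)) for every Borel set A, where ν(Γ(A)) is the ν-outer measure of Γ(A). -/

import Mathlib

open MeasureTheory Set

/-- A structure (P, Γ, ν) is internally consistent if there exists a probability law π
for the pair (Y, U) with marginals P and ν such that π({(y,u) : u ∈ Γ(y)}) = 1. -/
def InternallyConsistent {Y U : Type*} [MeasurableSpace Y] [MeasurableSpace U]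
    (P : MeasureTheory.Measure Y) (Γ : Y → Set U) (ν : MeasureTheory.Measure U) : Prop :=
  ∃ π : MeasureTheory.Measure (Y × U), MeasureTheory.IsProbabilityMeasure π ∧
    π.map Prod.fst = P ∧ π.map Prod.snd = ν ∧ π {p | p.2 ∈ Γ p.1} = 1

section Coupling

open Filter Topology ProbabilityTheory

/-- First-order stochastic dominance implies the inequality of expectations. -/
theorem integral_le_integral_of_measure_lt_le {α β : Type*} [MeasurableSpace α] [MeasurableSpace β]
    {μ : Measure α} {ν : Measure β} [IsProbabilityMeasure μ] [IsProbabilityMeasure ν]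
    {f : α → ℝ} {g : β → ℝ} (hf : Integrable f μ) (hg : Integrable g ν) {C : ℝ}
    (hCf : ∀ x, C ≤ f x) (hCg : ∀ x, C ≤ g x)
    (h : ∀ t, μ {x | t < f x} ≤ ν {x | t < g x}) : ∫ x, f x ∂μ ≤ ∫ x, g x ∂ν := by
  have hf' : Integrable (fun x ↦ f x - C) μ := hf.sub (integrable_const C)
  have hg' : Integrable (fun x ↦ g x - C) ν := hg.sub (integrable_const C)
  have hf0 : 0 ≤ᵐ[μ] fun x ↦ f x - C := ae_of_all _ fun x ↦ sub_nonneg.2 (hCf x)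
  have hg0 : 0 ≤ᵐ[ν] fun x ↦ g x - C := ae_of_all _ fun x ↦ sub_nonneg.2 (hCg x)
  have key : ∫⁻ x, ENNReal.ofReal (f x - C) ∂μ ≤ ∫⁻ x, ENNReal.ofReal (g x - C) ∂ν := by
    rw [lintegral_eq_lintegral_meas_lt μ hf0 hf'.aemeasurable,
      lintegral_eq_lintegral_meas_lt ν hg0 hg'.aemeasurable]
    refine lintegral_mono fun t ↦ ?_
    simpa only [lt_sub_iff_add_lt] using h (t + C)
  have key' : ∫ x, (f x - C) ∂μ ≤ ∫ x, (g x - C) ∂ν := by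
    rw [integral_eq_lintegral_of_nonneg_ae hf0 hf'.aestronglyMeasurable,
      integral_eq_lintegral_of_nonneg_ae hg0 hg'.aestronglyMeasurable]
    exact ENNReal.toReal_mono hg'.lintegral_lt_top.ne key
  rw [integral_sub hf (integrable_const C), integral_sub hg (integrable_const C)] at key'
  simpa using key'

/-- A fractional form of Hall's marriage theorem: two probability measures on finite types admit a
coupling supported on a relation `E` as soon as Hall's condition holds. -/
theorem exists_weights_of_measure_le_neighbors {ι κ : Type*} [Fintype ι] [Fintype κ]
    [MeasurableSpace ι] [MeasurableSingletonClass ι]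
    [MeasurableSpace κ] [MeasurableSingletonClass κ]
    (μ : Measure ι) (ν : Measure κ) [IsProbabilityMeasure μ] [IsProbabilityMeasure ν]
    (E : Set (ι × κ)) (h : ∀ A : Set ι, μ A ≤ ν {j | ∃ i ∈ A, (i, j) ∈ E}) :
    ∃ q : ι × κ → ℝ, (∀ e, 0 ≤ q e) ∧ (∀ e ∉ E, q e = 0) ∧
      (∀ i, ∑ j, q (i, j) = μ.real {i}) ∧ ∀ j, ∑ i, q (i, j) = ν.real {j} := by
  classical
  let K : Set (ι × κ → ℝ) := stdSimplex ℝ (ι × κ) ∩ ⋂ e ∈ Eᶜ, {q | q e = 0}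
  let L : (ι × κ → ℝ) →ₗ[ℝ] (ι → ℝ) × (κ → ℝ) :=
    { toFun := fun q ↦ (fun i ↦ ∑ j, q (i, j), fun j ↦ ∑ i, q (i, j))
      map_add' := fun x y ↦ by ext <;> simp [Finset.sum_add_distrib]
      map_smul' := fun c x ↦ by ext <;> simp [Finset.mul_sum] }
  have hKconv : Convex ℝ K := by
    refine (convex_stdSimplex ℝ _).inter (convex_iInter₂ fun e _ ↦ ?_)
    exact convex_hyperplane (f := fun q : ι × κ → ℝ ↦ q e) ⟨fun _ _ ↦ rfl, fun _ _ ↦ rfl⟩ 0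
  have hKcomp : IsCompact K :=
    (isCompact_stdSimplex ℝ _).inter_right <| isClosed_biInter fun e _ ↦
      isClosed_eq (continuous_apply e) continuous_const
  have hLcont : Continuous L := L.continuous_of_finiteDimensional
  by_cases hmem : ((fun i ↦ μ.real {i}, fun j ↦ ν.real {j}) : (ι → ℝ) × (κ → ℝ)) ∈ L '' K
  · obtain ⟨q, ⟨hq, hqE⟩, hqL⟩ := hmem
    refine ⟨q, hq.1, fun e he ↦ ?_, fun i ↦ congrFun (congrArg Prod.fst hqL) i,
      fun j ↦ congrFun (congrArg Prod.snd hqL) j⟩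
    simpa using mem_iInter₂.1 hqE e he
  exfalso
  obtain ⟨φ, s, hφ, hs⟩ := geometric_hahn_banach_closed_point (hKconv.linear_image L)
    (hKcomp.image hLcont).isClosed hmem
  let a : ι → ℝ := fun i ↦ φ (fun k ↦ if i = k then 1 else 0, 0)
  let b : κ → ℝ := fun j ↦ φ (0, fun k ↦ if j = k then 1 else 0)
  have hφab (v : ι → ℝ) (w : κ → ℝ) : φ (v, w) = ∑ i, v i * a i + ∑ j, w j * b j := by
    have hv : φ (v, 0) = ∑ i, v i * a i := by
      simpa [a] using (φ.toLinearMap ∘ₗ LinearMap.inl ℝ _ _).pi_apply_eq_sum_univ v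
    have hw : φ (0, w) = ∑ j, w j * b j := by
      simpa [b] using (φ.toLinearMap ∘ₗ LinearMap.inr ℝ _ _).pi_apply_eq_sum_univ w
    rw [← hv, ← hw, ← map_add]
    simp
  have hab (i : ι) (j : κ) (hij : (i, j) ∈ E) : a i < s - b j := by
    have hmemK : Pi.single (i, j) 1 ∈ K := by
      refine ⟨single_mem_stdSimplex ℝ _, mem_iInter₂.2 fun e he ↦ ?_⟩
      exact Pi.single_eq_of_ne (ne_of_mem_of_not_mem hij he).symm _
    have h1 := hφ _ (mem_image_of_mem L hmemK)
    have h2 : L (Pi.single (i, j) 1) = (Pi.single i 1, Pi.single j 1) := by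
      ext k <;> simp [L, Pi.single_apply, Prod.ext_iff, ite_and, Finset.sum_ite_eq']
    rw [h2, hφab] at h1
    simp [Pi.single_apply] at h1
    linarith
  obtain ⟨C, hC⟩ : ∃ C, (∀ i, C ≤ a i) ∧ ∀ j, C ≤ s - b j := by
    obtain ⟨C₁, h₁⟩ := (finite_range a).bddBelow
    obtain ⟨C₂, h₂⟩ := (finite_range fun j ↦ s - b j).bddBelow
    exact ⟨min C₁ C₂, fun i ↦ (min_le_left _ _).trans (h₁ (mem_range_self i)),
      fun j ↦ (min_le_right _ _).trans (h₂ (mem_range_self j))⟩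
  have hle : ∫ i, a i ∂μ ≤ ∫ j, (s - b j) ∂ν := by
    refine integral_le_integral_of_measure_lt_le .of_finite .of_finite hC.1 hC.2 fun t ↦ ?_
    refine (h _).trans (measure_mono ?_)
    rintro j ⟨i, hi, hij⟩
    exact lt_trans hi (hab i j hij)
  rw [integral_sub .of_finite .of_finite, integral_fintype .of_finite,
    integral_fintype (μ := ν) (f := b) .of_finite] at hle
  rw [hφab] at hs
  simp at hle hs
  linarith

/-- If Hall's condition holds for finite measurable discretizations `f` and `g` of two probability
spaces, then there is a coupling which lives on the discretized relation. -/
theorem exists_coupling_of_measure_preimage_le {Y U ι κ : Type*} [MeasurableSpace Y]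
    [MeasurableSpace U] [Fintype ι] [Fintype κ] [MeasurableSpace ι] [DiscreteMeasurableSpace ι]
    [MeasurableSpace κ] [DiscreteMeasurableSpace κ]
    (P : Measure Y) (ν : Measure U) [IsProbabilityMeasure P] [IsProbabilityMeasure ν]
    {f : Y → ι} {g : U → κ} (hf : Measurable f) (hg : Measurable g) (E : Set (ι × κ))
    (h : ∀ A : Set ι, P (f ⁻¹' A) ≤ ν (g ⁻¹' {j | ∃ i ∈ A, (i, j) ∈ E})) :
    ∃ π : Measure (Y × U), π.map Prod.fst = P ∧ π.map Prod.snd = ν ∧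
      π {p | (f p.1, g p.2) ∉ E} = 0 := by
  have : IsProbabilityMeasure (P.map f) := Measure.isProbabilityMeasure_map hf.aemeasurable
  have : IsProbabilityMeasure (ν.map g) := Measure.isProbabilityMeasure_map hg.aemeasurable
  obtain ⟨q, hq0, hqE, hq1, hq2⟩ := exists_weights_of_measure_le_neighbors (P.map f) (ν.map g) E
    fun A ↦ by
      rw [Measure.map_apply hf .of_discrete, Measure.map_apply hg .of_discrete]
      exact h A
  have hr (i : ι) : ∑ j, ENNReal.ofReal (q (i, j)) = P (f ⁻¹' {i}) := by
    rw [← ENNReal.ofReal_sum_of_nonneg fun j _ ↦ hq0 (i, j), hq1, ofReal_measureReal,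
      Measure.map_apply hf .of_discrete]
  have hc (j : κ) : ∑ i, ENNReal.ofReal (q (i, j)) = ν (g ⁻¹' {j}) := by
    rw [← ENNReal.ofReal_sum_of_nonneg fun i _ ↦ hq0 (i, j), hq2, ofReal_measureReal,
      Measure.map_apply hg .of_discrete]
  have hcond1 (i : ι) (j : κ) :
      ENNReal.ofReal (q (i, j)) * P[|f ⁻¹' {i}] univ = ENNReal.ofReal (q (i, j)) := by
    by_cases h0 : P (f ⁻¹' {i}) = 0
    · rw [← hr, Finset.sum_eq_zero_iff] at h0
      simp [h0 j (Finset.mem_univ j)]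
    · have := cond_isProbabilityMeasure h0
      rw [measure_univ, mul_one]
  have hcond2 (i : ι) (j : κ) :
      ENNReal.ofReal (q (i, j)) * ν[|g ⁻¹' {j}] univ = ENNReal.ofReal (q (i, j)) := by
    by_cases h0 : ν (g ⁻¹' {j}) = 0
    · rw [← hc, Finset.sum_eq_zero_iff] at h0
      simp [h0 i (Finset.mem_univ i)]
    · have := cond_isProbabilityMeasure h0
      rw [measure_univ, mul_one]
  refine ⟨∑ e, ENNReal.ofReal (q e) • (P[|f ⁻¹' {e.1}]).prod (ν[|g ⁻¹' {e.2}]), ?_, ?_, ?_⟩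
  · conv_rhs => rw [← sum_meas_smul_cond_fiber hf P]
    ext s hs
    rw [Measure.map_apply measurable_fst hs, ← prod_univ]
    simp only [Measure.coe_finsetSum, Finset.sum_apply, Measure.smul_apply, Measure.prod_prod,
      smul_eq_mul, Fintype.sum_prod_type]
    refine Finset.sum_congr rfl fun i _ ↦ ?_
    rw [← hr, Finset.sum_mul]
    refine Finset.sum_congr rfl fun j _ ↦ ?_
    rw [mul_left_comm, hcond2, mul_comm]
  · conv_rhs => rw [← sum_meas_smul_cond_fiber hg ν]
    ext s hs
    rw [Measure.map_apply measurable_snd hs, ← univ_prod]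
    simp only [Measure.coe_finsetSum, Finset.sum_apply, Measure.smul_apply, Measure.prod_prod,
      smul_eq_mul, Fintype.sum_prod_type_right]
    refine Finset.sum_congr rfl fun j _ ↦ ?_
    rw [← hc, Finset.sum_mul]
    refine Finset.sum_congr rfl fun i _ ↦ ?_
    rw [← mul_assoc, hcond1]
  · simp only [Measure.coe_finsetSum, Finset.sum_apply, Measure.smul_apply, smul_eq_mul,
      Finset.sum_eq_zero_iff, mul_eq_zero, Finset.mem_univ, true_imp_iff]
    intro e
    by_cases he : e ∈ E
    · right
      have h1 : ∀ᵐ p ∂(P[|f ⁻¹' {e.1}]).prod (ν[|g ⁻¹' {e.2}]), f p.1 = e.1 :=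
        Measure.quasiMeasurePreserving_fst.ae (ae_cond_mem (hf .of_discrete))
      have h2 : ∀ᵐ p ∂(P[|f ⁻¹' {e.1}]).prod (ν[|g ⁻¹' {e.2}]), g p.2 = e.2 :=
        Measure.quasiMeasurePreserving_snd.ae (ae_cond_mem (hg .of_discrete))
      have h3 : ∀ᵐ p ∂(P[|f ⁻¹' {e.1}]).prod (ν[|g ⁻¹' {e.2}]), (f p.1, g p.2) ∈ E := by
        filter_upwards [h1, h2] with p hp1 hp2
        rwa [hp1, hp2]
      exact h3
    · simp [hqE e he]

/-- Up to small measure, a separable metric probability space is partitioned by finitely many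
measurable sets of small diameter. -/
theorem exists_measurable_fin_dist_lt {X : Type*} [PseudoMetricSpace X]
    [SecondCountableTopology X] [MeasurableSpace X] [OpensMeasurableSpace X]
    (μ : Measure X) [IsProbabilityMeasure μ] {δ : ℝ} (hδ : 0 < δ) {ε : ENNReal} (hε : 0 < ε) :
    ∃ (N : ℕ) (f : X → Fin (N + 1)), Measurable f ∧ μ (f ⁻¹' {Fin.last N}) ≤ ε ∧
      ∀ x y, f x = f y → f x ≠ Fin.last N → dist x y < δ := by
  classical
  have : Nonempty X := μ.nonempty_of_neZero
  have hex (x : X) : ∃ k, dist x (TopologicalSpace.denseSeq X k) < δ / 2 := by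
    simpa using (TopologicalSpace.denseRange_denseSeq X).exists_dist_lt x (half_pos hδ)
  let F : X → ℕ := fun x ↦ Nat.find (hex x)
  have hF : Measurable F := measurable_find hex fun k ↦
    (isOpen_lt (continuous_id.dist continuous_const) continuous_const).measurableSet
  have hlim : Tendsto (fun N ↦ μ (F ⁻¹' Ici N)) atTop (𝓝 0) := by
    have := tendsto_measure_iInter_atTop (μ := μ) (s := fun N ↦ F ⁻¹' Ici N)
      (fun N ↦ (hF measurableSet_Ici).nullMeasurableSet)
      (fun m n hmn ↦ preimage_mono (Ici_subset_Ici.2 hmn)) ⟨0, measure_ne_top _ _⟩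
    have hempty : ⋂ N, F ⁻¹' Ici N = ∅ := by
      refine eq_empty_of_forall_notMem fun x hx ↦ ?_
      have := mem_iInter.1 hx (F x + 1)
      simp at this
    rwa [hempty, measure_empty] at this
  obtain ⟨N, hN⟩ := (hlim.eventually_le_const hε).exists
  refine ⟨N, fun x ↦ Fin.ofNat (N + 1) (min (F x) N), ?_, ?_, ?_⟩
  · exact (Measurable.of_discrete (f := fun n ↦ Fin.ofNat (N + 1) (min n N))).comp hF
  · refine (measure_mono fun x hx ↦ ?_).trans hN
    have h1 := congrArg Fin.val hx
    simp only [Fin.val_ofNat, Fin.val_last] at h1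
    rw [Nat.mod_eq_of_lt (by omega)] at h1
    simpa using h1
  · intro x y hxy hx
    have h1 := congrArg Fin.val hxy
    have h2 := Fin.val_ne_of_ne hx
    simp only [Fin.val_ofNat, Fin.val_last] at h1 h2
    rw [Nat.mod_eq_of_lt (by omega), Nat.mod_eq_of_lt (by omega)] at h1
    rw [Nat.mod_eq_of_lt (by omega)] at h2
    have hF' : F x = F y := by omega
    have hx' := Nat.find_spec (hex x)
    have hy' := Nat.find_spec (hex y)
    change dist x (TopologicalSpace.denseSeq X (F x)) < δ / 2 at hx'
    change dist y (TopologicalSpace.denseSeq X (F y)) < δ / 2 at hy'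
    rw [← hF'] at hy'
    linarith [dist_triangle_right x y (TopologicalSpace.denseSeq X (F x))]

/-- Hall's condition yields couplings which are almost concentrated near the graph. -/
theorem exists_coupling_compl_cthickening_le {Y U : Type*} [PseudoMetricSpace Y]
    [SecondCountableTopology Y] [MeasurableSpace Y] [OpensMeasurableSpace Y]
    [PseudoMetricSpace U] [SecondCountableTopology U] [MeasurableSpace U] [OpensMeasurableSpace U]
    (P : Measure Y) (ν : Measure U) [IsProbabilityMeasure P] [IsProbabilityMeasure ν]
    (Γ : Y → Set U) (h : ∀ A : Set Y, MeasurableSet A → P A ≤ ν (⋃ a ∈ A, Γ a))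
    {δ : ℝ} (hδ : 0 < δ) {ε : ENNReal} (hε : 0 < ε) :
    ∃ π : Measure (Y × U), π.map Prod.fst = P ∧ π.map Prod.snd = ν ∧
      π (Metric.cthickening δ {p : Y × U | p.2 ∈ Γ p.1})ᶜ ≤ ε := by
  obtain ⟨M, f, hf, hfε, hfδ⟩ := exists_measurable_fin_dist_lt P hδ (ENNReal.half_pos hε.ne')
  obtain ⟨N, g, hg, hgε, hgδ⟩ := exists_measurable_fin_dist_lt ν hδ (ENNReal.half_pos hε.ne')
  let E : Set (Fin (M + 1) × Fin (N + 1)) := {e | ∃ y, ∃ u ∈ Γ y, (f y, g u) = e}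
  obtain ⟨π, hπ1, hπ2, hπE⟩ := exists_coupling_of_measure_preimage_le P ν hf hg E fun A ↦ by
    refine (h _ (hf .of_discrete)).trans (measure_mono (iUnion₂_subset fun y hy u hu ↦ ?_))
    exact ⟨f y, hy, y, u, hu, rfl⟩
  refine ⟨π, hπ1, hπ2, ?_⟩
  have hsub : (Metric.cthickening δ {p : Y × U | p.2 ∈ Γ p.1})ᶜ ⊆
      {p | (f p.1, g p.2) ∉ E} ∪
        (Prod.fst ⁻¹' (f ⁻¹' {Fin.last M}) ∪ Prod.snd ⁻¹' (g ⁻¹' {Fin.last N})) := by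
    intro p hp
    by_contra hcon
    simp only [mem_union, mem_ofPred_eq, not_or, not_not, mem_preimage, mem_singleton_iff] at hcon
    obtain ⟨⟨y, u, hu, hyu⟩, hp1, hp2⟩ := hcon
    rw [Prod.mk.injEq] at hyu
    refine hp (Metric.mem_cthickening_of_dist_le p (y, u) δ _ hu ?_)
    rw [Prod.dist_eq, max_le_iff]
    exact ⟨(hfδ _ _ hyu.1.symm hp1).le, (hgδ _ _ hyu.2.symm hp2).le⟩
  calc π (Metric.cthickening δ {p : Y × U | p.2 ∈ Γ p.1})ᶜ
      ≤ 0 + (P (f ⁻¹' {Fin.last M}) + ν (g ⁻¹' {Fin.last N})) := by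
        refine (measure_mono hsub).trans ((measure_union_le _ _).trans ?_)
        rw [hπE]
        refine add_le_add_right ((measure_union_le _ _).trans_eq ?_) _
        rw [← Measure.map_apply measurable_fst (hf .of_discrete), hπ1,
          ← Measure.map_apply measurable_snd (hg .of_discrete), hπ2]
    _ ≤ ε := by
        rw [zero_add, ← ENNReal.add_halves ε]
        exact add_le_add hfε hgε

/-- The set of couplings of two probability measures on Polish spaces is weakly compact. -/
theorem isCompact_setOf_coupling {Y U : Type*} [MetricSpace Y] [CompleteSpace Y]
    [SecondCountableTopology Y] [MeasurableSpace Y] [BorelSpace Y]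
    [MetricSpace U] [CompleteSpace U] [SecondCountableTopology U] [MeasurableSpace U]
    [BorelSpace U] (P : ProbabilityMeasure Y) (ν : ProbabilityMeasure U) :
    IsCompact {π : ProbabilityMeasure (Y × U) |
      π.map measurable_fst.aemeasurable = P ∧ π.map measurable_snd.aemeasurable = ν} := by
  refine (isCompact_closure_of_isTightMeasureSet ?_).of_isClosed_subset ?_ subset_closure
  · refine IsTightMeasureSet.prodMk (isTightMeasureSet_singleton (μ := (P : Measure Y)).subset ?_)
      (isTightMeasureSet_singleton (μ := (ν : Measure U)).subset ?_)
    · rintro _ ⟨_, ⟨π, hπ, rfl⟩, rfl⟩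
      exact congrArg ProbabilityMeasure.toMeasure hπ.1
    · rintro _ ⟨_, ⟨π, hπ, rfl⟩, rfl⟩
      exact congrArg ProbabilityMeasure.toMeasure hπ.2
  · exact (isClosed_eq (ProbabilityMeasure.continuous_map continuous_fst) continuous_const).inter
      (isClosed_eq (ProbabilityMeasure.continuous_map continuous_snd) continuous_const)

/-- **Strassen's theorem** for a closed relation on Polish spaces. -/
theorem internallyConsistent_of_measure_le {Y U : Type*} [MetricSpace Y] [CompleteSpace Y]
    [SecondCountableTopology Y] [MeasurableSpace Y] [BorelSpace Y]
    [MetricSpace U] [CompleteSpace U] [SecondCountableTopology U] [MeasurableSpace U]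
    [BorelSpace U] (P : Measure Y) (ν : Measure U) [IsProbabilityMeasure P]
    [IsProbabilityMeasure ν] (Γ : Y → Set U) (hΓ : IsClosed {p : Y × U | p.2 ∈ Γ p.1})
    (h : ∀ A : Set Y, MeasurableSet A → P A ≤ ν (⋃ a ∈ A, Γ a)) :
    InternallyConsistent P Γ ν := by
  let G : Set (Y × U) := {p | p.2 ∈ Γ p.1}
  let δ : ℕ → ℝ := fun n ↦ 1 / ((n : ℝ) + 1)
  have hδ (n : ℕ) : 0 < δ n := Nat.one_div_pos_of_nat
  have hδlim : Tendsto δ atTop (𝓝 0) := tendsto_one_div_add_atTop_nhds_zero_nat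
  choose π hπ1 hπ2 hπG using fun n ↦ exists_coupling_compl_cthickening_le P ν Γ h (hδ n)
    (ENNReal.ofReal_pos.2 (hδ n))
  have hprob (n : ℕ) : IsProbabilityMeasure (π n) := by
    have : IsProbabilityMeasure ((π n).map Prod.fst) := by rw [hπ1]; infer_instance
    exact Measure.isProbabilityMeasure_of_map Prod.fst
  let ρ : ℕ → ProbabilityMeasure (Y × U) := fun n ↦ ⟨π n, hprob n⟩
  obtain ⟨σ, hσ, hlim⟩ := (isCompact_setOf_coupling ⟨P, ‹_›⟩ ⟨ν, ‹_›⟩).ultrafilter_le_nhds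
    ((hyperfilter ℕ).map ρ) (by
      refine tendsto_principal.2 (Eventually.of_forall fun n ↦ ⟨?_, ?_⟩)
      · exact Subtype.ext (hπ1 n)
      · exact Subtype.ext (hπ2 n))
  have hσlim : Tendsto ρ (hyperfilter ℕ) (𝓝 σ) := hlim
  have hnull (m : ℕ) : (σ : Measure (Y × U)) (Metric.cthickening (δ m) G)ᶜ = 0 := by
    refine nonpos_iff_eq_zero.1 ?_
    refine (ProbabilityMeasure.le_liminf_measure_open_of_tendsto hσlim
      Metric.isClosed_cthickening.isOpen_compl).trans ?_
    have h0 : Tendsto (fun n ↦ ENNReal.ofReal (δ n)) (hyperfilter ℕ) (𝓝 0) := by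
      simpa using (ENNReal.tendsto_ofReal hδlim).mono_left Nat.hyperfilter_le_atTop
    rw [← h0.liminf_eq]
    refine liminf_le_liminf ?_
    filter_upwards [Nat.hyperfilter_le_atTop (eventually_ge_atTop m)] with n hn
    refine (measure_mono (compl_subset_compl.2 (Metric.cthickening_mono ?_ G))).trans (hπG n)
    exact Nat.one_div_le_one_div hn
  refine ⟨σ, inferInstance, congrArg ProbabilityMeasure.toMeasure hσ.1,
    congrArg ProbabilityMeasure.toMeasure hσ.2, ?_⟩
  change (σ : Measure (Y × U)) G = 1
  rw [← prob_compl_eq_zero_iff hΓ.measurableSet]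
  have hG : Gᶜ = ⋃ m, (Metric.cthickening (δ m) G)ᶜ := by
    have hcl : closure G = G := hΓ.closure_eq
    rw [← compl_iInter, ← biInter_range (f := δ) (g := fun r ↦ Metric.cthickening r G),
      ← Metric.closure_eq_iInter_cthickening' G (range δ), hcl]
    intro ε hε
    obtain ⟨n, hn⟩ := exists_nat_one_div_lt hε
    exact ⟨δ n, mem_range_self n, hδ n, hn.le⟩
  rw [hG, measure_iUnion_null_iff]
  exact hnull

/-- Internal consistency implies Hall's condition for every measurable event. -/
theorem InternallyConsistent.measure_le {Y U : Type*} [MeasurableSpace Y] [MeasurableSpace U]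
    {P : Measure Y} {ν : Measure U} {Γ : Y → Set U}
    (hΓ : MeasurableSet {p : Y × U | p.2 ∈ Γ p.1}) (h : InternallyConsistent P Γ ν)
    {A : Set Y} (hA : MeasurableSet A) : P A ≤ ν (⋃ a ∈ A, Γ a) := by
  obtain ⟨π, hπ, rfl, rfl, hπΓ⟩ := h
  have hae : ∀ᵐ p ∂π, p.2 ∈ Γ p.1 := (prob_compl_eq_zero_iff hΓ).2 hπΓ
  rw [Measure.map_apply measurable_fst hA]
  calc π (Prod.fst ⁻¹' A)
      ≤ π (Prod.snd ⁻¹' (⋃ a ∈ A, Γ a)) :=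
        measure_mono_ae (hae.mono fun p hp hpA ↦ mem_iUnion₂_of_mem hpA hp)
    _ ≤ π.map Prod.snd (⋃ a ∈ A, Γ a) := Measure.le_map_apply measurable_snd.aemeasurable _

end Coupling

/-- Proposition 1 of the paper: if the graph of Γ is closed, the structure
(P, Γ, ν) is internally consistent if and only if P(A) ≤ ν(Γ(A)) for every Borel set A,
where ν(Γ(A)) denotes the ν-outer measure of Γ(A) = ⋃_{a ∈ A} Γ(a). -/
theorem stmt_1 {dy du : ℕ}
    (P : Measure (Fin dy → ℝ)) [IsProbabilityMeasure P]
    (ν : Measure (Fin du → ℝ)) [IsProbabilityMeasure ν]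
    (Γ : (Fin dy → ℝ) → Set (Fin du → ℝ))
    (hΓmeas : ∀ O : Set (Fin du → ℝ), IsOpen O → MeasurableSet {y | (Γ y ∩ O).Nonempty})
    (hΓne : ∀ y, (Γ y).Nonempty) (hΓcl : ∀ y, IsClosed (Γ y))
    (hgraph : IsClosed {p : (Fin dy → ℝ) × (Fin du → ℝ) | p.2 ∈ Γ p.1}) :
    InternallyConsistent P Γ ν ↔
      ∀ A : Set (Fin dy → ℝ), MeasurableSet A → P A ≤ ν (⋃ a ∈ A, Γ a) := by
  exact ⟨fun h _ hA ↦ h.measure_le hgraph.measurableSet hA,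
    internallyConsistent_of_measure_le P ν Γ hgraph⟩
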